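/- arXiv:1904.06669 — 2 statements merged into one kernel-verified Lean document; each statement's English description precedes it below -/
import Mathlib

section
/- Euclidean space ℝ^n (n ≥ 2) is n-parabolic: for every compact set K ⊆ ℝ^n and every ε > 0 there exists a smooth, compactly supported function ξ : ℝ^n → ℝ with 0 ≤ ξ ≤ 1, ξ = 1 on K, and such that the gradient ∇ξ satisfies ‖ ‖∇ξ‖ ‖_{L^n(ℝ^n)} < ε. -/
open MeasureTheory

theorem Finset.sum_pow_of_pairwise_zero {ι : Type*} (s : Finset ι) (a : ι → ℝ) {n : ℕ}
    (hn : n ≠ 0) (h : ∀ i ∈ s, ∀ j ∈ s, a i ≠ 0 → a j ≠ 0 → i = j) :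
    (∑ i ∈ s, a i) ^ n = ∑ i ∈ s, a i ^ n := by
  by_cases hz : ∃ k ∈ s, a k ≠ 0
  · obtain ⟨k, hk, hak⟩ := hz
    have h0 : ∀ i ∈ s, i ≠ k → a i = 0 := fun i hi hik ↦ by
      by_contra hai
      exact hik (h i hi k hk hai hak)
    rw [Finset.sum_eq_single_of_mem k hk h0,
      Finset.sum_eq_single_of_mem k hk fun i hi hik ↦ by rw [h0 i hi hik, zero_pow hn]]
  · push Not at hz
    rw [Finset.sum_eq_zero hz, zero_pow hn,
      Finset.sum_eq_zero fun i hi ↦ by rw [hz i hi, zero_pow hn]]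

theorem norm_gradient_eq_norm_fderiv {E : Type*} [NormedAddCommGroup E] [InnerProductSpace ℝ E]
    [CompleteSpace E] (f : E → ℝ) (x : E) : ‖gradient f x‖ = ‖fderiv ℝ f x‖ := by
  simp [gradient]

section Dilates

variable {E : Type*} [NormedAddCommGroup E] [InnerProductSpace ℝ E]

/-- The average of the dilates of `φ` by the factors `3 ^ k`, `k < N`. -/
noncomputable def averagedDilates (φ : E → ℝ) (N : ℕ) (x : E) : ℝ :=
  (N : ℝ)⁻¹ * ∑ k ∈ Finset.range N, φ (((3 : ℝ) ^ k)⁻¹ • x)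

theorem contDiff_averagedDilates {φ : E → ℝ} (hφ : ContDiff ℝ (⊤ : ℕ∞) φ) (N : ℕ) :
    ContDiff ℝ (⊤ : ℕ∞) (averagedDilates φ N) := by
  unfold averagedDilates
  fun_prop

theorem hasCompactSupport_averagedDilates {φ : E → ℝ} (hφ : HasCompactSupport φ) (N : ℕ) :
    HasCompactSupport (averagedDilates φ N) := by
  have h : ∀ s : Finset ℕ,
      HasCompactSupport fun x ↦ ∑ k ∈ s, φ (((3 : ℝ) ^ k)⁻¹ • x) := by
    intro s
    induction s using Finset.induction_on with
    | empty => exact HasCompactSupport.zero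
    | insert a s ha ih =>
      simp only [Finset.sum_insert ha]
      exact (hφ.comp_smul (by positivity)).add ih
  exact (h _).mul_left

theorem averagedDilates_mem_Icc {φ : E → ℝ} (hφ : ∀ x, φ x ∈ Set.Icc (0 : ℝ) 1) (N : ℕ) (x : E) :
    averagedDilates φ N x ∈ Set.Icc (0 : ℝ) 1 := by
  constructor
  · exact mul_nonneg (by positivity) (Finset.sum_nonneg fun k _ ↦ (hφ _).1)
  · have h : ∑ k ∈ Finset.range N, φ (((3 : ℝ) ^ k)⁻¹ • x) ≤ N := by
      simpa using Finset.sum_le_card_nsmul (Finset.range N) _ 1 fun k _ ↦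
        (hφ (((3 : ℝ) ^ k)⁻¹ • x)).2
    exact inv_mul_le_one_of_le₀ h (by positivity)

theorem averagedDilates_eq_one {φ : E → ℝ} {R : ℝ} (hφ : ∀ x, ‖x‖ ≤ R → φ x = 1) {N : ℕ}
    (hN : N ≠ 0) {x : E} (hx : ‖x‖ ≤ R) : averagedDilates φ N x = 1 := by
  have h : ∀ k ∈ Finset.range N, φ (((3 : ℝ) ^ k)⁻¹ • x) = 1 := fun k _ ↦ by
    apply hφ
    rw [norm_smul, norm_inv, norm_pow, Real.norm_ofNat]
    refine le_trans (mul_le_of_le_one_left (norm_nonneg x) ?_) hx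
    exact inv_le_one_of_one_le₀ (one_le_pow₀ (by norm_num))
  rw [averagedDilates, Finset.sum_congr rfl h]
  simp [hN]

theorem norm_fderiv_averagedDilates_le {φ : E → ℝ} (hφ : Differentiable ℝ φ) (N : ℕ) (x : E) :
    ‖fderiv ℝ (averagedDilates φ N) x‖ ≤ (N : ℝ)⁻¹ *
      ∑ k ∈ Finset.range N, ((3 : ℝ) ^ k)⁻¹ * ‖fderiv ℝ φ (((3 : ℝ) ^ k)⁻¹ • x)‖ := by
  have hd : ∀ k ∈ Finset.range N,
      DifferentiableAt ℝ (fun y ↦ φ (((3 : ℝ) ^ k)⁻¹ • y)) x := fun k _ ↦ by fun_prop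
  unfold averagedDilates
  rw [fderiv_const_mul (DifferentiableAt.fun_sum hd), fderiv_fun_sum hd, norm_smul, norm_inv,
    Real.norm_natCast]
  gcongr
  refine (norm_sum_le _ _).trans (Finset.sum_le_sum fun k _ ↦ le_of_eq ?_)
  rw [fderiv_comp_smul, norm_smul, norm_inv, norm_pow, Real.norm_ofNat]

theorem eq_of_mem_annulus_of_mem_annulus {R : ℝ} (hR : 0 < R) {x : E} {i j : ℕ}
    (hi : R ≤ ‖((3 : ℝ) ^ i)⁻¹ • x‖ ∧ ‖((3 : ℝ) ^ i)⁻¹ • x‖ ≤ 2 * R)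
    (hj : R ≤ ‖((3 : ℝ) ^ j)⁻¹ • x‖ ∧ ‖((3 : ℝ) ^ j)⁻¹ • x‖ ≤ 2 * R) : i = j := by
  have key : ∀ a b : ℕ, ‖((3 : ℝ) ^ a)⁻¹ • x‖ ≤ 2 * R → R ≤ ‖((3 : ℝ) ^ b)⁻¹ • x‖ → b ≤ a := by
    intro a b ha hb
    rw [norm_smul, norm_inv, norm_pow, Real.norm_ofNat, inv_mul_le_iff₀ (by positivity)] at ha
    rw [norm_smul, norm_inv, norm_pow, Real.norm_ofNat, le_inv_mul_iff₀ (by positivity)] at hb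
    by_contra! hab
    have h3 : (3 : ℝ) ^ (a + 1) ≤ 3 ^ b := pow_le_pow_right₀ (by norm_num) hab
    have h4 : (3 : ℝ) ^ (a + 1) * R ≤ 3 ^ b * R := by gcongr
    have h5 : 0 < (3 : ℝ) ^ a * R := by positivity
    rw [pow_succ] at h4
    linarith
  exact le_antisymm (key j i hj.2 hi.1) (key i j hi.2 hj.1)

variable [FiniteDimensional ℝ E]

theorem ContDiffBump.fderiv_eq_zero_of_mem_ball {c : E} (φ : ContDiffBump c) {x : E}
    (hx : x ∈ Metric.ball c φ.rIn) : fderiv ℝ φ x = 0 := by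
  have h : (φ : E → ℝ) =ᶠ[nhds x] fun _ ↦ 1 := by
    filter_upwards [Metric.isOpen_ball.mem_nhds hx] with y hy
    exact φ.one_of_mem_closedBall (Metric.ball_subset_closedBall hy)
  rw [h.fderiv_eq, fderiv_const_apply]

theorem ContDiffBump.mem_annulus_of_fderiv_ne_zero {c : E} (φ : ContDiffBump c) {x : E}
    (hx : fderiv ℝ φ x ≠ 0) : φ.rIn ≤ dist x c ∧ dist x c ≤ φ.rOut := by
  constructor
  · by_contra! h
    exact hx (φ.fderiv_eq_zero_of_mem_ball h)
  · have := support_fderiv_subset ℝ (f := (φ : E → ℝ)) hx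
    rwa [φ.tsupport_eq] at this

variable [MeasurableSpace E] [BorelSpace E]

theorem integral_scaled_norm_fderiv_pow (φ : E → ℝ) {c : ℝ} (hc : 0 < c) :
    ∫ x, (c * ‖fderiv ℝ φ (c • x)‖) ^ Module.finrank ℝ E =
      ∫ x, ‖fderiv ℝ φ x‖ ^ Module.finrank ℝ E := by
  simp_rw [mul_pow]
  rw [integral_const_mul,
    Measure.integral_comp_smul volume (fun y ↦ ‖fderiv ℝ φ y‖ ^ Module.finrank ℝ E) c,
    abs_of_pos (by positivity), smul_eq_mul, mul_inv_cancel_left₀ (by positivity)]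

/-- The conformal energy of the averaged dilates of a bump function decays with the number of
dilates, because the gradients of the dilates have disjoint supports and equal energies. -/
theorem integral_norm_fderiv_averagedDilates_le (φ : ContDiffBump (0 : E))
    (hφ : φ.rOut = 2 * φ.rIn) (hE : Module.finrank ℝ E ≠ 0) (N : ℕ) :
    ∫ x, ‖fderiv ℝ (averagedDilates φ N) x‖ ^ Module.finrank ℝ E ≤
      (N : ℝ)⁻¹ ^ Module.finrank ℝ E * (N * ∫ x, ‖fderiv ℝ φ x‖ ^ Module.finrank ℝ E) := by
  set n := Module.finrank ℝ E with hn
  have hsmooth : ContDiff ℝ (⊤ : ℕ∞) (φ : E → ℝ) := φ.contDiff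
  have hcont : Continuous (fderiv ℝ (φ : E → ℝ)) := hsmooth.continuous_fderiv (by simp)
  have hint : ∀ k : ℕ, Integrable fun x : E ↦
      (((3 : ℝ) ^ k)⁻¹ * ‖fderiv ℝ φ (((3 : ℝ) ^ k)⁻¹ • x)‖) ^ n := by
    intro k
    have hc : ((3 : ℝ) ^ k)⁻¹ ≠ 0 := by positivity
    refine Continuous.integrable_of_hasCompactSupport (by fun_prop) ?_
    have hs : HasCompactSupport fun y : E ↦ (((3 : ℝ) ^ k)⁻¹ * ‖fderiv ℝ φ y‖) ^ n :=
      (φ.hasCompactSupport.fderiv ℝ).comp_left (g := fun L ↦ (((3 : ℝ) ^ k)⁻¹ * ‖L‖) ^ n)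
        (by simp [hE])
    exact hs.comp_smul hc
  have hpt : ∀ x : E, ‖fderiv ℝ (averagedDilates φ N) x‖ ^ n ≤ (N : ℝ)⁻¹ ^ n *
      ∑ k ∈ Finset.range N, (((3 : ℝ) ^ k)⁻¹ * ‖fderiv ℝ φ (((3 : ℝ) ^ k)⁻¹ • x)‖) ^ n := by
    intro x
    rw [← Finset.sum_pow_of_pairwise_zero _ _ hE, ← mul_pow]
    · gcongr
      exact norm_fderiv_averagedDilates_le (hsmooth.differentiable (by simp)) N x
    · intro i _ j _ hi hj
      have h : ∀ k : ℕ, ((3 : ℝ) ^ k)⁻¹ * ‖fderiv ℝ φ (((3 : ℝ) ^ k)⁻¹ • x)‖ ≠ 0 →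
          φ.rIn ≤ ‖((3 : ℝ) ^ k)⁻¹ • x‖ ∧ ‖((3 : ℝ) ^ k)⁻¹ • x‖ ≤ 2 * φ.rIn := fun k hk ↦ by
        simpa only [dist_zero_right, hφ] using
          φ.mem_annulus_of_fderiv_ne_zero (norm_ne_zero_iff.1 (right_ne_zero_of_mul hk))
      exact eq_of_mem_annulus_of_mem_annulus φ.rIn_pos (h i hi) (h j hj)
  calc ∫ x, ‖fderiv ℝ (averagedDilates φ N) x‖ ^ n
      ≤ ∫ x, (N : ℝ)⁻¹ ^ n *
          ∑ k ∈ Finset.range N, (((3 : ℝ) ^ k)⁻¹ * ‖fderiv ℝ φ (((3 : ℝ) ^ k)⁻¹ • x)‖) ^ n :=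
        integral_mono_of_nonneg (.of_forall fun x ↦ by positivity)
          ((integrable_finsetSum _ fun k _ ↦ hint k).const_mul _) (.of_forall hpt)
    _ = (N : ℝ)⁻¹ ^ n * (N * ∫ x, ‖fderiv ℝ φ x‖ ^ n) := by
        rw [integral_const_mul, integral_finsetSum _ fun k _ ↦ hint k,
          Finset.sum_congr rfl fun k _ ↦
            integral_scaled_norm_fderiv_pow (φ : E → ℝ) (c := ((3 : ℝ) ^ k)⁻¹) (by positivity)]
        simp [n]

end Dilates

/-- Euclidean space `ℝⁿ` (`n ≥ 2`) is `n`-parabolic: for every compact set `K`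
and every `ε > 0` there is a smooth compactly supported function with values in
`[0,1]`, equal to `1` on `K`, whose gradient has `Lⁿ` norm less than `ε`. -/
theorem euclidean_n_parabolic
    (n : ℕ) (hn : 2 ≤ n)
    (K : Set (EuclideanSpace ℝ (Fin n))) (hK : IsCompact K)
    (ε : ℝ) (hε : 0 < ε) :
    ∃ ξ : EuclideanSpace ℝ (Fin n) → ℝ,
      ContDiff ℝ (⊤ : ℕ∞) ξ ∧ HasCompactSupport ξ ∧
      (∀ x, 0 ≤ ξ x ∧ ξ x ≤ 1) ∧
      (∀ x ∈ K, ξ x = 1) ∧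
      (∫ x : EuclideanSpace ℝ (Fin n), ‖gradient ξ x‖ ^ (n : ℝ)) ^ ((n : ℝ)⁻¹)
        < ε := by
  obtain ⟨R, hR, hKR⟩ := hK.isBounded.exists_pos_norm_le
  let φ : ContDiffBump (0 : EuclideanSpace ℝ (Fin n)) := ⟨R, 2 * R, hR, by linarith⟩
  have hrank : Module.finrank ℝ (EuclideanSpace ℝ (Fin n)) = n := by simp
  set C := ∫ x, ‖fderiv ℝ φ x‖ ^ n with hC
  have hC0 : 0 ≤ C := integral_nonneg fun x ↦ by positivity
  obtain ⟨N, hN⟩ := exists_nat_gt (C / ε ^ n)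
  have hN0 : 0 < (N : ℝ) := lt_of_le_of_lt (by positivity) hN
  have henergy : ∫ x, ‖fderiv ℝ (averagedDilates φ N) x‖ ^ n < ε ^ n := by
    have h := integral_norm_fderiv_averagedDilates_le φ rfl (by rw [hrank]; lia) N
    rw [hrank, ← hC] at h
    refine h.trans_lt ?_
    have hinv : (N : ℝ)⁻¹ ^ n ≤ (N : ℝ)⁻¹ ^ 2 :=
      pow_le_pow_of_le_one (by positivity)
        (inv_le_one_of_one_le₀ (by exact_mod_cast hN0)) hn
    calc (N : ℝ)⁻¹ ^ n * (N * C) ≤ (N : ℝ)⁻¹ ^ 2 * (N * C) := by gcongr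
      _ = C / N := by field_simp
      _ < ε ^ n := by
        rw [div_lt_iff₀ (by positivity)] at hN ⊢
        linarith
  refine ⟨averagedDilates φ N, contDiff_averagedDilates φ.contDiff N,
    hasCompactSupport_averagedDilates φ.hasCompactSupport N,
    averagedDilates_mem_Icc (fun x ↦ ⟨φ.nonneg, φ.le_one⟩) N, fun x hx ↦ ?_, ?_⟩
  · refine averagedDilates_eq_one (R := R) (fun y hy ↦ ?_) (by exact_mod_cast hN0.ne') (hKR x hx)
    exact φ.one_of_mem_closedBall (mem_closedBall_zero_iff.2 hy)
  · simp_rw [norm_gradient_eq_norm_fderiv, Real.rpow_natCast]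
    rw [Real.rpow_inv_lt_iff_of_pos (integral_nonneg fun x ↦ by positivity) hε.le
      (by exact_mod_cast (by lia : 0 < n)), Real.rpow_natCast]
    exact henergy
end

section
/- Let n ≥ 3 and fix radii 0 < μ < 1 < λ < μ'. Denote by A' = {x ∈ ℝ^n : μ < ‖x‖ < μ'} the larger open annulus and by A = {x ∈ ℝ^n : 1 < ‖x‖ < λ} the smaller one. There exists a constant C > 0 such that every continuously differentiable map X : A' → ℝ^n that is integrable on A' and satisfies the closedness condition ∂X_i/∂x_j = ∂X_j/∂x_i on A' admits a continuously differentiable function u : A → ℝ with ∇u = X on A and ‖u‖_{L^1(A)} ≤ C ‖X‖_{L^1(A')}. -/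
open MeasureTheory Set Topology ENNReal

section Poincare

variable {E : Type*} [NormedAddCommGroup E] [NormedSpace ℝ E] [FiniteDimensional ℝ E]
  [MeasurableSpace E] [BorelSpace E] (ν : Measure E) [ν.IsAddHaarMeasure]

/-- Integrating `g` along a contraction of ratio `t ≥ 1/2` costs at most a factor `2 ^ dim E`. -/
theorem lintegral_comp_add_smul_le {g : E → ℝ≥0∞} (hg : Measurable g) {t : ℝ} (ht : 1 / 2 ≤ t)
    (v : E) : ∫⁻ x, g (v + t • x) ∂ν ≤ 2 ^ Module.finrank ℝ E * ∫⁻ x, g x ∂ν := by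
  have ht0 : 0 < t := by linarith
  have h1 : ∫⁻ x, g (v + t • x) ∂ν = ∫⁻ x, g (v + x) ∂(Measure.map (t • ·) ν) :=
    (lintegral_map (hg.comp (measurable_const_add v)) (measurable_const_smul t)).symm
  rw [h1, Measure.map_addHaar_smul ν ht0.ne', lintegral_smul_measure, lintegral_add_left_eq_self,
    smul_eq_mul]
  gcongr
  rw [abs_of_pos (by positivity), ← inv_pow, ENNReal.ofReal_pow (by positivity)]
  gcongr
  rw [show (2 : ℝ≥0∞) = ENNReal.ofReal 2 by simp]
  apply ENNReal.ofReal_le_ofReal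
  rw [inv_le_comm₀ ht0 two_pos]
  linarith

omit [FiniteDimensional ℝ E] [MeasurableSpace E] [BorelSpace E] in
theorem enorm_sub_le_lintegral_enorm_fderiv {B : Set E} (hBo : IsOpen B) (hB : Convex ℝ B)
    {d : ℝ} (hd : ∀ x ∈ B, ∀ y ∈ B, ‖y - x‖ ≤ d) {f : E → ℝ} (hf : ContDiffOn ℝ 1 f B)
    {x y : E} (hx : x ∈ B) (hy : y ∈ B) :
    ‖f y - f x‖ₑ ≤ ENNReal.ofReal d *
      ∫⁻ t in Icc (0 : ℝ) 1, B.indicator (fun z => ‖fderiv ℝ f z‖ₑ) (x + t • (y - x)) := by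
  have hmem : ∀ t ∈ Icc (0 : ℝ) 1, x + t • (y - x) ∈ B := fun t ht =>
    hB.add_smul_sub_mem hx hy ht
  have hc : ContDiffOn ℝ 1 (fun t : ℝ => f (x + t • (y - x))) (Icc 0 1) :=
    hf.comp (by fun_prop) hmem
  have h := enorm_sub_le_lintegral_deriv_of_contDiffOn_Icc hc zero_le_one
  simp only [one_smul, add_sub_cancel, zero_smul, add_zero] at h
  refine h.trans ?_
  rw [← lintegral_const_mul' _ _ ENNReal.ofReal_ne_top]
  refine setLIntegral_mono' measurableSet_Icc fun t ht => ?_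
  have hd' : HasDerivAt (fun t : ℝ => f (x + t • (y - x)))
      (fderiv ℝ f (x + t • (y - x)) (y - x)) t := by
    have h1 := ((hf.differentiableOn one_ne_zero).differentiableAt
      (hBo.mem_nhds (hmem t ht))).hasFDerivAt
    have h2 : HasDerivAt (fun t : ℝ => x + t • (y - x)) (y - x) t := by
      simpa using ((hasDerivAt_id t).smul_const (y - x)).const_add x
    exact h1.comp_hasDerivAt t h2
  rw [hd'.deriv, indicator_of_mem (hmem t ht), mul_comm]
  refine (ContinuousLinearMap.le_opENorm _ _).trans ?_
  gcongr
  rw [← ofReal_norm]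
  exact ENNReal.ofReal_le_ofReal (hd x hx y hy)

theorem lintegral_lintegral_comp_segment_le {B : Set E} {g : E → ℝ≥0∞} (hg : Measurable g)
    (t : ℝ) :
    ∫⁻ x in B, ∫⁻ y in B, g (x + t • (y - x)) ∂ν ∂ν ≤
      2 ^ Module.finrank ℝ E * ν B * ∫⁻ z, g z ∂ν := by
  have key : ∀ s : ℝ, 1 / 2 ≤ s → ∀ v : E → E,
      ∫⁻ x in B, ∫⁻ y in B, g (v x + s • y) ∂ν ∂ν ≤
      2 ^ Module.finrank ℝ E * ν B * ∫⁻ z, g z ∂ν := by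
    intro s hs v
    calc ∫⁻ x in B, ∫⁻ y in B, g (v x + s • y) ∂ν ∂ν
        ≤ ∫⁻ x in B, 2 ^ Module.finrank ℝ E * ∫⁻ z, g z ∂ν ∂ν :=
          lintegral_mono fun x => (setLIntegral_le_lintegral _ _).trans
            (lintegral_comp_add_smul_le ν hg hs _)
      _ = _ := by rw [setLIntegral_const]; ring
  rcases le_total (1 / 2) t with ht | ht
  · convert key t ht (fun x => x - t • x) using 6 with x y
    module
  · rw [lintegral_lintegral_swap]
    · convert key (1 - t) (by linarith) (fun x => t • x) using 6 with x y
      module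
    · exact (hg.comp (by fun_prop)).aemeasurable

/-- The `L¹`-Poincaré inequality on a bounded convex open set, in double integral form. -/
theorem lintegral_lintegral_enorm_sub_le {B : Set E} (hBo : IsOpen B) (hB : Convex ℝ B)
    {d : ℝ} (hd : ∀ x ∈ B, ∀ y ∈ B, ‖y - x‖ ≤ d) {f : E → ℝ} (hf : ContDiffOn ℝ 1 f B) :
    ∫⁻ x in B, ∫⁻ y in B, ‖f y - f x‖ₑ ∂ν ∂ν ≤
      ENNReal.ofReal d * (2 ^ Module.finrank ℝ E * ν B) * ∫⁻ z in B, ‖fderiv ℝ f z‖ₑ ∂ν := by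
  set g : E → ℝ≥0∞ := B.indicator (fun z => ‖fderiv ℝ f z‖ₑ) with hgdef
  have hg : Measurable g := (measurable_fderiv ℝ f).enorm.indicator hBo.measurableSet
  rw [← lintegral_indicator hBo.measurableSet (fun z => ‖fderiv ℝ f z‖ₑ), ← hgdef]
  calc ∫⁻ x in B, ∫⁻ y in B, ‖f y - f x‖ₑ ∂ν ∂ν
      ≤ ∫⁻ x in B, ∫⁻ y in B, ENNReal.ofReal d *
          (∫⁻ t in Icc (0 : ℝ) 1, g (x + t • (y - x))) ∂ν ∂ν :=
        setLIntegral_mono' hBo.measurableSet fun x hx =>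
          setLIntegral_mono' hBo.measurableSet fun y hy =>
            enorm_sub_le_lintegral_enorm_fderiv hBo hB hd hf hx hy
    _ = ENNReal.ofReal d * ∫⁻ t in Icc (0 : ℝ) 1,
          (∫⁻ x in B, ∫⁻ y in B, g (x + t • (y - x)) ∂ν ∂ν) := by
        simp_rw [lintegral_const_mul' _ _ (ENNReal.ofReal_ne_top (r := d))]
        congr 1
        have h1 : ∀ x, ∫⁻ y in B, (∫⁻ t in Icc (0 : ℝ) 1, g (x + t • (y - x))) ∂ν =
            ∫⁻ t in Icc (0 : ℝ) 1, ∫⁻ y in B, g (x + t • (y - x)) ∂ν := fun x =>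
          lintegral_lintegral_swap (hg.comp (by fun_prop)).aemeasurable
        simp_rw [h1]
        refine lintegral_lintegral_swap (Measurable.aemeasurable ?_)
        have h2 : Measurable fun p : (E × ℝ) × E => g (p.1.1 + p.1.2 • (p.2 - p.1.1)) :=
          hg.comp (by fun_prop)
        exact h2.lintegral_prod_right'
    _ ≤ ENNReal.ofReal d * ∫⁻ t in Icc (0 : ℝ) 1,
          (2 ^ Module.finrank ℝ E * ν B * ∫⁻ z, g z ∂ν) := by
        gcongr with t
        exact lintegral_lintegral_comp_segment_le ν hg t
    _ = _ := by simp [mul_assoc]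

/-- `V` is controlled by `W` inside `U`: the `L¹` norm of a `C¹` function on `V` is bounded by the
`L¹` norm of its derivative on `U` and its own `L¹` norm on `W`. -/
def L1Controlled (U V W : Set E) : Prop :=
  ∃ C : ℝ≥0∞, C ≠ ∞ ∧ ∀ f : E → ℝ, ContDiffOn ℝ 1 f U →
    ∫⁻ x in V, ‖f x‖ₑ ∂ν ≤ C * (∫⁻ x in U, ‖fderiv ℝ f x‖ₑ ∂ν + ∫⁻ x in W, ‖f x‖ₑ ∂ν)

variable {ν}

omit [FiniteDimensional ℝ E] [BorelSpace E] [ν.IsAddHaarMeasure] in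
theorem L1Controlled.trans {U V W Z : Set E} (h₁ : L1Controlled ν U V W)
    (h₂ : L1Controlled ν U W Z) : L1Controlled ν U V Z := by
  obtain ⟨C, hC, h₁⟩ := h₁
  obtain ⟨D, hD, h₂⟩ := h₂
  refine ⟨C * (1 + D), by finiteness, fun f hf => (h₁ f hf).trans ?_⟩
  rw [mul_assoc]
  gcongr
  rw [add_mul, one_mul]
  exact add_le_add le_self_add (h₂ f hf)

omit [FiniteDimensional ℝ E] [BorelSpace E] [ν.IsAddHaarMeasure] in
theorem L1Controlled.mono {U V V' W : Set E} (h : L1Controlled ν U V W) (hV : V' ⊆ V) :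
    L1Controlled ν U V' W := by
  obtain ⟨C, hC, h⟩ := h
  exact ⟨C, hC, fun f hf => (lintegral_mono_set hV).trans (h f hf)⟩

omit [FiniteDimensional ℝ E] [BorelSpace E] [ν.IsAddHaarMeasure] in
theorem L1Controlled.union {U V V' W : Set E} (h : L1Controlled ν U V W)
    (h' : L1Controlled ν U V' W) : L1Controlled ν U (V ∪ V') W := by
  obtain ⟨C, hC, h⟩ := h
  obtain ⟨D, hD, h'⟩ := h'
  refine ⟨C + D, by finiteness, fun f hf => (lintegral_union_le _ _ _).trans ?_⟩
  rw [add_mul]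
  exact add_le_add (h f hf) (h' f hf)

theorem L1Controlled.of_ball {U : Set E} {a : E} {r : ℝ} (hr : Metric.ball a r ⊆ U) {q : E}
    (hq : q ∈ Metric.ball a r) {W : Set E} (hW : W ∈ 𝓝 q) :
    L1Controlled ν U (Metric.ball a r) W := by
  set B := Metric.ball a r
  set W₀ := interior W ∩ B
  have hBo : IsOpen B := Metric.isOpen_ball
  have hW₀o : IsOpen W₀ := isOpen_interior.inter hBo
  have hpos : ν W₀ ≠ 0 := (hW₀o.measure_pos ν ⟨q, mem_interior_iff_mem_nhds.2 hW, hq⟩).ne'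
  have hBfin : ν B ≠ ∞ := measure_ball_lt_top.ne
  have hfin : ν W₀ ≠ ∞ := measure_ne_top_of_subset inter_subset_right hBfin
  have hd : ∀ x ∈ B, ∀ y ∈ B, ‖y - x‖ ≤ 2 * r := fun x hx y hy => by
    rw [← dist_eq_norm]
    linarith [dist_triangle_right y x a, Metric.mem_ball.1 hx, Metric.mem_ball.1 hy]
  set K : ℝ≥0∞ := ENNReal.ofReal (2 * r) * (2 ^ Module.finrank ℝ E * ν B)
  have hK : K ≠ ∞ := by finiteness
  refine ⟨(ν W₀)⁻¹ * (K + ν B), ENNReal.mul_ne_top (ENNReal.inv_ne_top.2 hpos) (by finiteness),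
    fun f hf => ?_⟩
  have hfB := hf.mono hr
  have hmeas : AEMeasurable (fun w => ν B * ‖f w‖ₑ) (ν.restrict W₀) :=
    ((hfB.continuousOn.mono inter_subset_right).aemeasurable hW₀o.measurableSet).enorm.const_mul _
  rw [mul_assoc, ← ENNReal.mul_le_iff_le_inv hpos hfin]
  calc ν W₀ * ∫⁻ x in B, ‖f x‖ₑ ∂ν = ∫⁻ w in W₀, ∫⁻ x in B, ‖f x‖ₑ ∂ν ∂ν := by
        rw [setLIntegral_const, mul_comm]
    _ ≤ ∫⁻ w in W₀, ((∫⁻ x in B, ‖f x - f w‖ₑ ∂ν) + ν B * ‖f w‖ₑ) ∂ν := by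
        refine lintegral_mono fun w => ?_
        rw [mul_comm, ← setLIntegral_const, ← lintegral_add_right _ measurable_const]
        refine lintegral_mono fun x => ?_
        simpa using enorm_add_le (f x - f w) (f w)
    _ = (∫⁻ w in W₀, ∫⁻ x in B, ‖f x - f w‖ₑ ∂ν ∂ν) + ∫⁻ w in W₀, ν B * ‖f w‖ₑ ∂ν :=
        lintegral_add_right' _ hmeas
    _ ≤ K * (∫⁻ x in U, ‖fderiv ℝ f x‖ₑ ∂ν) + ν B * ∫⁻ x in W, ‖f x‖ₑ ∂ν := by
        refine add_le_add ?_ ?_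
        · refine (lintegral_mono_set inter_subset_right).trans
            ((lintegral_lintegral_enorm_sub_le ν hBo (convex_ball a r) hd hfB).trans ?_)
          gcongr
        · rw [lintegral_const_mul' _ _ hBfin]
          gcongr
          exact inter_subset_left.trans interior_subset
    _ ≤ _ := by
        rw [add_mul, mul_add, mul_add]
        exact add_le_add le_self_add le_add_self

theorem L1Controlled.of_isPreconnected {U : Set E} (hU : IsOpen U) (hUc : IsPreconnected U)
    {K : Set E} (hK : IsCompact K) (hKU : K ⊆ U) {q : E} (hq : q ∈ U) {W : Set E}
    (hW : W ∈ 𝓝 q) : L1Controlled ν U K W := by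
  have hloc : ∀ p ∈ U, ∀ W ∈ 𝓝 q, ∃ V ∈ 𝓝 p, L1Controlled ν U V W := fun p hp => by
    refine hUc.induction₂' (fun p q => ∀ W ∈ 𝓝 q, ∃ V ∈ 𝓝 p, L1Controlled ν U V W)
      (fun x hx => ?_) (fun x y z _ _ _ hxy hyz W hW => ?_) hp hq
    · obtain ⟨r, hr0, hr⟩ := Metric.isOpen_iff.1 hU x hx
      filter_upwards [mem_nhdsWithin_of_mem_nhds (Metric.ball_mem_nhds x hr0)] with y hy
      exact ⟨fun W hW => ⟨_, Metric.ball_mem_nhds x hr0, .of_ball hr hy hW⟩,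
        fun W hW => ⟨_, Metric.isOpen_ball.mem_nhds hy,
          .of_ball hr (Metric.mem_ball_self hr0) hW⟩⟩
    · obtain ⟨V, hV, h₁⟩ := hyz W hW
      obtain ⟨V', hV', h₂⟩ := hxy V hV
      exact ⟨V', hV', h₂.trans h₁⟩
  refine hK.induction_on (p := fun s => L1Controlled ν U s W) ⟨0, by simp, by simp⟩
    (fun s t hst ht => ht.mono hst) (fun s t hs ht => hs.union ht) fun x hx => ?_
  obtain ⟨V, hV, h⟩ := hloc x (hKU hx) W hW
  exact ⟨V, mem_nhdsWithin_of_mem_nhds hV, h⟩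

/-- The `L¹`-Poincaré inequality on a compact subset of a connected open set. -/
theorem exists_lintegral_enorm_sub_const_le {U : Set E} (hU : IsOpen U) (hUc : IsConnected U)
    {K : Set E} (hK : IsCompact K) (hKU : K ⊆ U) :
    ∃ C : ℝ≥0∞, C ≠ ∞ ∧ ∀ f : E → ℝ, ContDiffOn ℝ 1 f U → ∃ c : ℝ,
      ∫⁻ x in K, ‖f x - c‖ₑ ∂ν ≤ C * ∫⁻ x in U, ‖fderiv ℝ f x‖ₑ ∂ν := by
  obtain ⟨q, hq⟩ := hUc.nonempty
  obtain ⟨r, hr0, hr⟩ := Metric.isOpen_iff.1 hU q hq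
  set B := Metric.ball q r
  have hBo : IsOpen B := Metric.isOpen_ball
  have hpos : ν B ≠ 0 := (Metric.measure_ball_pos ν q hr0).ne'
  have hBfin : ν B ≠ ∞ := measure_ball_lt_top.ne
  have hd : ∀ x ∈ B, ∀ y ∈ B, ‖y - x‖ ≤ 2 * r := fun x hx y hy => by
    rw [← dist_eq_norm]
    linarith [dist_triangle_right y x q, Metric.mem_ball.1 hx, Metric.mem_ball.1 hy]
  obtain ⟨C, hC, h⟩ := L1Controlled.of_isPreconnected (ν := ν) hU hUc.isPreconnected hK hKU hq
    (Metric.ball_mem_nhds q hr0)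
  set D : ℝ≥0∞ := ENNReal.ofReal (2 * r) * (2 ^ Module.finrank ℝ E * ν B)
  have hD : D ≠ ∞ := by finiteness
  refine ⟨C * (1 + (ν B)⁻¹ * D), ENNReal.mul_ne_top hC (ENNReal.add_ne_top.2 ⟨by simp,
    ENNReal.mul_ne_top (ENNReal.inv_ne_top.2 hpos) hD⟩), fun f hf => ?_⟩
  have hfB := hf.mono hr
  obtain ⟨y, hy, hyle⟩ : ∃ y ∈ B, ∫⁻ x in B, ‖f x - f y‖ₑ ∂ν ≤
      (ν B)⁻¹ * (D * ∫⁻ x in U, ‖fderiv ℝ f x‖ₑ ∂ν) := by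
    have hfm : AEMeasurable f (ν.restrict B) := hfB.continuousOn.aemeasurable hBo.measurableSet
    have hm : AEMeasurable (fun y => ∫⁻ x in B, ‖f x - f y‖ₑ ∂ν) (ν.restrict B) :=
      (hfm.comp_snd.sub hfm.comp_fst).enorm.lintegral_prod_right'
    obtain ⟨y, hy, hle⟩ := exists_le_setLAverage hpos hBfin hm
    refine ⟨y, hy, hle.trans ?_⟩
    rw [setLAverage_eq, ENNReal.div_eq_inv_mul]
    gcongr
    refine (lintegral_lintegral_enorm_sub_le ν hBo (convex_ball q r) hd hfB).trans ?_
    gcongr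
  refine ⟨f y, (h (fun x => f x - f y) (hf.sub contDiffOn_const)).trans ?_⟩
  rw [mul_assoc]
  gcongr
  simp only [fderiv_sub_const]
  rw [add_mul, one_mul, mul_assoc]
  gcongr

end Poincare

section Primitive

variable {E : Type*} [NormedAddCommGroup E] [NormedSpace ℝ E]

/-- A closed `1`-form on a star-shaped open set has a primitive. -/
theorem StarConvex.exists_hasFDerivAt_of_fderiv_symmetric {U : Set E} (hU : IsOpen U) {e : E}
    (hs : StarConvex ℝ e U) {ω : E → E →L[ℝ] ℝ} (hω : DifferentiableOn ℝ ω U)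
    (hdω : ∀ a ∈ U, ∀ x y, fderiv ℝ ω a x y = fderiv ℝ ω a y x) :
    ∃ f : E → ℝ, ∀ x ∈ U, HasFDerivAt f (ω x) x := by
  refine ⟨fun x => curveIntegral ω (.segment e x), fun x hx => ?_⟩
  have hcpt : IsCompact (segment ℝ e x) := by
    rw [segment_eq_image_lineMap]
    exact isCompact_Icc.image (by fun_prop)
  obtain ⟨δ, hδ, hsub⟩ := hcpt.exists_thickening_subset_open hU (hs.segment_subset hx)
  have hmem : ∀ y ∈ segment ℝ e x, y ∈ Metric.thickening δ (segment ℝ e x) :=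
    fun y hy => Metric.self_subset_thickening hδ _ hy
  have hxT := hmem x (right_mem_segment ℝ e x)
  have hd : ∀ a ∈ U, HasFDerivAt ω (fderiv ℝ ω a) a := fun a ha =>
    (hω.differentiableAt (hU.mem_nhds ha)).hasFDerivAt
  exact (((convex_segment e x).thickening δ
    ).hasFDerivWithinAt_curveIntegral_segment_of_hasFDerivWithinAt_symmetric
    (fun a ha => (hd a (hsub ha)).hasFDerivWithinAt) (fun a ha v _ w _ => hdω a (hsub ha) v w)
    (hmem e (left_mem_segment ℝ e x)) hxT).hasFDerivAt (Metric.isOpen_thickening.mem_nhds hxT)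

theorem exists_hasFDerivAt_union {U V : Set E} (hU : IsOpen U) (hV : IsOpen V)
    (hUV : IsPreconnected (U ∩ V)) {ω : E → E →L[ℝ] ℝ} {f g : E → ℝ}
    (hf : ∀ x ∈ U, HasFDerivAt f (ω x) x) (hg : ∀ x ∈ V, HasFDerivAt g (ω x) x) :
    ∃ h : E → ℝ, ∀ x ∈ U ∪ V, HasFDerivAt h (ω x) x := by
  classical
  obtain ⟨c, hc⟩ := (hU.inter hV).exists_eq_add_of_fderiv_eq hUV
    (fun x hx => (hf x hx.1).differentiableAt.differentiableWithinAt)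
    (fun x hx => (hg x hx.2).differentiableAt.differentiableWithinAt)
    (fun x hx => (hf x hx.1).fderiv.trans (hg x hx.2).fderiv.symm)
  refine ⟨U.piecewise f (g · + c), fun x hx => ?_⟩
  rcases hx with hx | hx
  · refine (hf x hx).congr_of_eventuallyEq ?_
    filter_upwards [hU.mem_nhds hx] with y hy
    rw [piecewise_eq_of_mem _ _ _ hy]
  · refine ((hg x hx).add_const c).congr_of_eventuallyEq ?_
    filter_upwards [hV.mem_nhds hx] with y hy
    by_cases hyU : y ∈ U
    · rw [piecewise_eq_of_mem _ _ _ hyU, hc ⟨hyU, hy⟩]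
    · rw [piecewise_eq_of_notMem _ _ _ hyU]

/-- The pullback of a closed `1`-form under a `C²` map is closed. -/
theorem fderiv_pullback_symmetric {W : Set E} (hW : IsOpen W) {ω : E → E →L[ℝ] ℝ}
    (hω : DifferentiableOn ℝ ω W)
    (hdω : ∀ a ∈ W, ∀ x y, fderiv ℝ ω a x y = fderiv ℝ ω a y x) {Φ : E → E} {x : E}
    (hΦ : ContDiffAt ℝ 2 Φ x) (hx : Φ x ∈ W) :
    DifferentiableAt ℝ (fun y => (ω (Φ y)).comp (fderiv ℝ Φ y)) x ∧
      ∀ v w, fderiv ℝ (fun y => (ω (Φ y)).comp (fderiv ℝ Φ y)) x v w =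
        fderiv ℝ (fun y => (ω (Φ y)).comp (fderiv ℝ Φ y)) x w v := by
  have hd : DifferentiableAt ℝ (fun y => (ω (Φ y)).comp (fderiv ℝ Φ y)) x := by
    refine DifferentiableAt.clm_comp ?_ ?_
    · exact (hω.differentiableAt (hW.mem_nhds hx)).comp x (hΦ.differentiableAt two_ne_zero)
    · exact (hΦ.fderiv_right (m := 1) (by norm_num)).differentiableAt one_ne_zero
  refine ⟨hd, fun v w => ?_⟩
  obtain ⟨r, hr0, hr⟩ := Metric.isOpen_iff.1 hW _ hx
  obtain ⟨g, hg⟩ := (convex_ball (Φ x) r).exists_forall_hasFDerivAt_of_fderiv_symmetric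
    Metric.isOpen_ball (hω.mono hr) fun a ha => hdω a (hr ha)
  refine second_derivative_symmetric_of_eventually (f := g ∘ Φ) (𝕜 := ℝ) ?_ hd.hasFDerivAt v w
  filter_upwards [hΦ.continuousAt.preimage_mem_nhds (Metric.ball_mem_nhds _ hr0),
    hΦ.eventually (by simp)] with y hy hy'
  exact (hg _ hy).comp y (hy'.differentiableAt two_ne_zero).hasFDerivAt

end Primitive

section Shell

variable {E : Type*} [NormedAddCommGroup E] [InnerProductSpace ℝ E]

/-- The complement of the closed ray spanned by `-e` is star-shaped about the unit vector `e`. -/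
theorem starConvex_setOf_norm_add_inner_ne_zero {e : E} (he : ‖e‖ = 1) :
    StarConvex ℝ e {x : E | ‖x‖ + inner ℝ x e ≠ 0} := by
  intro x hx a b ha hb hab h0
  refine hx ?_
  set y := a • e + b • x
  have h1 : inner ℝ y (-e) = ‖y‖ * ‖-e‖ := by
    rw [inner_neg_right, norm_neg, he]
    linarith
  rw [inner_eq_norm_mul_iff_real, norm_neg, he, one_smul] at h1
  have h2 : b • x = -(‖y‖ + a) • e := by
    have : b • x = y - a • e := by simp [y]
    rw [this]
    conv_lhs => rw [h1]
    module
  have hee : inner ℝ e e = 1 := by rw [real_inner_self_eq_norm_sq, he, one_pow]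
  have h3 : b * (‖x‖ + inner ℝ x e) = 0 := by
    have h4 : b * ‖x‖ = ‖b • x‖ := by rw [norm_smul, Real.norm_of_nonneg hb]
    rw [mul_add, h4, ← real_inner_smul_left, h2, norm_smul, real_inner_smul_left, hee, he,
      Real.norm_eq_abs, abs_neg, abs_of_nonneg (by positivity)]
    ring
  rcases mul_eq_zero.1 h3 with hb0 | h
  · have hye : y = e := by
      rw [hb0, add_zero] at hab
      simp [y, hb0, hab]
    rw [hye, hee, he] at h0
    norm_num at h0
  · exact h

/-- A closed `1`-form on the complement of the origin has a primitive in dimension at least `3`. -/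
theorem exists_hasFDerivAt_compl_zero [FiniteDimensional ℝ E] (hE : 3 ≤ Module.finrank ℝ E)
    {ω : E → E →L[ℝ] ℝ} (hω : DifferentiableOn ℝ ω {0}ᶜ)
    (hdω : ∀ a ∈ ({0}ᶜ : Set E), ∀ x y, fderiv ℝ ω a x y = fderiv ℝ ω a y x) :
    ∃ f : E → ℝ, ∀ x ∈ ({0}ᶜ : Set E), HasFDerivAt f (ω x) x := by
  have : Nontrivial E := Module.nontrivial_of_finrank_pos (R := ℝ) (by omega)
  obtain ⟨e, he⟩ := exists_norm_eq E zero_le_one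
  have he' : ‖-e‖ = 1 := by rw [norm_neg, he]
  have hopen : ∀ e : E, IsOpen {x : E | ‖x‖ + inner ℝ x e ≠ 0} := fun e =>
    isOpen_ne_fun (by fun_prop) continuous_const
  have hsub : ∀ e : E, {x : E | ‖x‖ + inner ℝ x e ≠ 0} ⊆ {0}ᶜ := by
    rintro e x hx rfl
    simp at hx
  have hprim : ∀ e : E, ‖e‖ = 1 → ∃ f : E → ℝ, ∀ x ∈ {x : E | ‖x‖ + inner ℝ x e ≠ 0},
      HasFDerivAt f (ω x) x := fun e he =>
    (starConvex_setOf_norm_add_inner_ne_zero he).exists_hasFDerivAt_of_fderiv_symmetric (hopen e)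
      (hω.mono (hsub e)) fun a ha => hdω a (hsub e ha)
  obtain ⟨f, hf⟩ := hprim e he
  obtain ⟨g, hg⟩ := hprim (-e) he'
  have hinter : {x : E | ‖x‖ + inner ℝ x e ≠ 0} ∩ {x : E | ‖x‖ + inner ℝ x (-e) ≠ 0} =
      ((ℝ ∙ e : Submodule ℝ E) : Set E)ᶜ := by
    ext x
    simp only [mem_inter_iff, mem_ofPred_eq, mem_compl_iff, SetLike.mem_coe,
      Submodule.mem_span_singleton, inner_neg_right]
    rw [← not_or, not_iff_not]
    constructor
    · rintro (h | h)
      · have h1 : inner ℝ x (-e) = ‖x‖ * ‖-e‖ := by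
          rw [inner_neg_right, he']
          linarith
        rw [inner_eq_norm_mul_iff_real, he', one_smul] at h1
        exact ⟨-‖x‖, by rw [neg_smul, ← smul_neg, ← h1]⟩
      · have h1 : inner ℝ x e = ‖x‖ * ‖e‖ := by
          rw [he]
          linarith
        rw [inner_eq_norm_mul_iff_real, he, one_smul] at h1
        exact ⟨‖x‖, h1.symm⟩
    · rintro ⟨t, rfl⟩
      rw [norm_smul, real_inner_smul_left, real_inner_self_eq_norm_sq, he, Real.norm_eq_abs]
      rcases abs_cases t with h | h <;> [right; left] <;> rw [h.1] <;> ring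
  have hconn : IsPreconnected ((ℝ ∙ e : Submodule ℝ E) : Set E)ᶜ := by
    refine (isConnected_compl_of_one_lt_codim ?_).isPreconnected
    have h1 := (ℝ ∙ e).finrank_quotient_add_finrank
    have h2 : Module.finrank ℝ (ℝ ∙ e) = 1 :=
      finrank_span_singleton (norm_ne_zero_iff.1 (he ▸ one_ne_zero))
    rw [← Module.finrank_eq_rank]
    exact_mod_cast (by omega : 1 < Module.finrank ℝ (E ⧸ (ℝ ∙ e)))
  obtain ⟨h, hh⟩ := exists_hasFDerivAt_union (hopen e) (hopen (-e)) (hinter ▸ hconn) hf hg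
  refine ⟨h, fun x hx => hh x ?_⟩
  by_contra hcon
  simp only [mem_union, mem_ofPred_eq, not_or, not_not, inner_neg_right] at hcon
  exact hx (norm_eq_zero.1 (by linarith))

/-- The radial map carrying the complement of the origin onto the shell of radii `a < b`. -/
noncomputable def toShell (a b : ℝ) (x : E) : E :=
  ((a + b * ‖x‖) / ((1 + ‖x‖) * ‖x‖)) • x

/-- The radial inverse of `toShell`. -/
noncomputable def ofShell (a b : ℝ) (x : E) : E :=
  ((‖x‖ - a) / ((b - ‖x‖) * ‖x‖)) • x

variable {a b : ℝ}

theorem norm_toShell (ha : 0 < a) (hab : a < b) {x : E} (hx : x ≠ 0) :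
    ‖toShell a b x‖ = (a + b * ‖x‖) / (1 + ‖x‖) := by
  have := norm_pos_iff.2 hx
  have := ha.trans hab
  rw [toShell, norm_smul, Real.norm_of_nonneg (by positivity)]
  field_simp

theorem norm_ofShell {x : E} (ha : 0 < a) (hx : a < ‖x‖ ∧ ‖x‖ < b) :
    ‖ofShell a b x‖ = (‖x‖ - a) / (b - ‖x‖) := by
  have h1 : 0 < ‖x‖ := ha.trans hx.1
  have h2 : 0 < ‖x‖ - a := sub_pos.2 hx.1
  have h3 : 0 < b - ‖x‖ := sub_pos.2 hx.2
  rw [ofShell, norm_smul, Real.norm_of_nonneg (by positivity)]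
  field_simp

theorem toShell_mem (ha : 0 < a) (hab : a < b) {x : E} (hx : x ≠ 0) :
    a < ‖toShell a b x‖ ∧ ‖toShell a b x‖ < b := by
  have := norm_pos_iff.2 hx
  rw [norm_toShell ha hab hx, lt_div_iff₀ (by positivity), div_lt_iff₀ (by positivity)]
  constructor <;> nlinarith

theorem ofShell_ne_zero (ha : 0 < a) {x : E} (hx : a < ‖x‖ ∧ ‖x‖ < b) : ofShell a b x ≠ 0 := by
  rw [← norm_pos_iff, norm_ofShell ha hx]
  exact div_pos (sub_pos.2 hx.1) (sub_pos.2 hx.2)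

theorem toShell_ofShell (ha : 0 < a) {x : E} (hx : a < ‖x‖ ∧ ‖x‖ < b) :
    toShell a b (ofShell a b x) = x := by
  have h1 : 0 < ‖x‖ := ha.trans hx.1
  have h2 : 0 < ‖x‖ - a := sub_pos.2 hx.1
  have h3 : 0 < b - ‖x‖ := sub_pos.2 hx.2
  have h4 : 0 < b - a := by linarith
  rw [toShell, norm_ofShell ha hx, ofShell, smul_smul]
  convert one_smul ℝ x
  have h5 : 1 + (‖x‖ - a) / (b - ‖x‖) = (b - a) / (b - ‖x‖) := by field_simp; ring
  have h6 : a + b * ((‖x‖ - a) / (b - ‖x‖)) = ‖x‖ * (b - a) / (b - ‖x‖) := by field_simp; ring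
  rw [h5, h6]
  field_simp

theorem contDiffAt_toShell {x : E} (hx : x ≠ 0) {n : WithTop ℕ∞} :
    ContDiffAt ℝ n (toShell a b) x := by
  have hn : ContDiffAt ℝ n (fun x : E => ‖x‖) x := contDiffAt_norm ℝ hx
  have := norm_pos_iff.2 hx
  exact ((contDiffAt_const.add (contDiffAt_const.mul hn)).div
    ((contDiffAt_const.add hn).mul hn) (by positivity)).smul contDiffAt_id

theorem differentiableAt_ofShell (ha : 0 < a) {x : E} (hx : a < ‖x‖ ∧ ‖x‖ < b) :
    DifferentiableAt ℝ (ofShell a b) x := by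
  have h1 : 0 < ‖x‖ := ha.trans hx.1
  have h3 : 0 < b - ‖x‖ := sub_pos.2 hx.2
  have hn : ContDiffAt ℝ 1 (fun x : E => ‖x‖) x := contDiffAt_norm ℝ (norm_pos_iff.1 h1)
  exact (((hn.sub contDiffAt_const).div ((contDiffAt_const.sub hn).mul hn)
    (mul_pos h3 h1).ne').smul contDiffAt_id).differentiableAt one_ne_zero

omit [InnerProductSpace ℝ E] in
theorem isOpen_shell : IsOpen {x : E | a < ‖x‖ ∧ ‖x‖ < b} :=
  (isOpen_lt continuous_const continuous_norm).inter (isOpen_lt continuous_norm continuous_const)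

theorem isConnected_shell [FiniteDimensional ℝ E] (hE : 2 ≤ Module.finrank ℝ E) (ha : 0 < a)
    (hab : a < b) : IsConnected {x : E | a < ‖x‖ ∧ ‖x‖ < b} := by
  have himage : {x : E | a < ‖x‖ ∧ ‖x‖ < b} = toShell a b '' {0}ᶜ := by
    ext x
    refine ⟨fun hx => ⟨_, ofShell_ne_zero ha hx, toShell_ofShell ha hx⟩, ?_⟩
    rintro ⟨y, hy, rfl⟩
    exact toShell_mem ha hab hy
  rw [himage]
  refine (isConnected_compl_singleton_of_one_lt_rank ?_ 0).image _ fun x hx =>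
    (contDiffAt_toShell (n := 0) hx).continuousAt.continuousWithinAt
  rw [← Module.finrank_eq_rank]
  exact_mod_cast hE

/-- A closed `1`-form on a shell has a primitive in dimension at least `3`. -/
theorem exists_hasFDerivAt_shell [FiniteDimensional ℝ E] (hE : 3 ≤ Module.finrank ℝ E)
    (ha : 0 < a) (hab : a < b) {ω : E → E →L[ℝ] ℝ}
    (hω : DifferentiableOn ℝ ω {x | a < ‖x‖ ∧ ‖x‖ < b})
    (hdω : ∀ p ∈ {x : E | a < ‖x‖ ∧ ‖x‖ < b}, ∀ x y, fderiv ℝ ω p x y = fderiv ℝ ω p y x) :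
    ∃ f : E → ℝ, ∀ x ∈ {x : E | a < ‖x‖ ∧ ‖x‖ < b}, HasFDerivAt f (ω x) x := by
  have hpull := fun (x : E) (hx : x ≠ 0) => fderiv_pullback_symmetric isOpen_shell hω hdω
    (contDiffAt_toShell (a := a) (b := b) hx) (toShell_mem ha hab hx)
  obtain ⟨f, hf⟩ := exists_hasFDerivAt_compl_zero hE
    (fun x hx => (hpull x hx).1.differentiableWithinAt) (fun x hx => (hpull x hx).2)
  refine ⟨f ∘ ofShell a b, fun x hx => ?_⟩
  have hΨ := (differentiableAt_ofShell ha hx).hasFDerivAt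
  have hy := ofShell_ne_zero ha hx
  have hid : (fderiv ℝ (toShell a b) (ofShell a b x)).comp (fderiv ℝ (ofShell a b) x) =
      ContinuousLinearMap.id ℝ E := by
    have h1 := ((contDiffAt_toShell (a := a) (b := b) (n := 1) hy).differentiableAt
      one_ne_zero).hasFDerivAt.comp x hΨ
    refine h1.unique ((hasFDerivAt_id x).congr_of_eventuallyEq ?_)
    filter_upwards [isOpen_shell.mem_nhds hx] with y hy
    exact toShell_ofShell ha hy
  have h2 := (hf _ hy).comp x hΨ
  rwa [ContinuousLinearMap.comp_assoc, hid, ContinuousLinearMap.comp_id,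
    toShell_ofShell ha hx] at h2

end Shell

/-- A linear endomorphism of Euclidean space with symmetric matrix is self-adjoint. -/
theorem inner_apply_symmetric_of_single {n : ℕ}
    {T : EuclideanSpace ℝ (Fin n) →L[ℝ] EuclideanSpace ℝ (Fin n)}
    (hT : ∀ i j, T (EuclideanSpace.single j 1) i = T (EuclideanSpace.single i 1) j)
    (x y : EuclideanSpace ℝ (Fin n)) :
    ((innerSL ℝ).comp T) x y = ((innerSL ℝ).comp T) y x := by
  have h : ((innerSL ℝ).comp T) = ((innerSL ℝ).comp T).flip := by
    refine ContinuousLinearMap.coe_injective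
      ((EuclideanSpace.basisFun (Fin n) ℝ).toBasis.ext fun i => ?_)
    refine ContinuousLinearMap.coe_injective
      ((EuclideanSpace.basisFun (Fin n) ℝ).toBasis.ext fun j => ?_)
    simpa [EuclideanSpace.inner_single_right] using hT j i
  exact congrArg (fun S => S x y) h

/-- `L¹`-Poincaré inequality on the Euclidean shell: for `n ≥ 3` and radii
`0 < μ < 1 < λ < μ'` there is a constant `C > 0` such that every `C¹` closed
`1`-form `X` on the larger annulus `A' = {μ < ‖x‖ < μ'}`, integrable on `A'`,
admits a `C¹` primitive `u` (`∇u = X`) on the smaller annulus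
`A = {1 < ‖x‖ < λ}` with `‖u‖_{L¹(A)} ≤ C ‖X‖_{L¹(A')}`. -/
theorem shell_L1_poincare
    (n : ℕ) (hn : 3 ≤ n) (μ lam μ' : ℝ)
    (h0μ : 0 < μ) (hμ1 : μ < 1) (h1lam : 1 < lam) (hlamμ' : lam < μ') :
    ∃ C > (0 : ℝ),
      ∀ X : EuclideanSpace ℝ (Fin n) → EuclideanSpace ℝ (Fin n),
      ContDiffOn ℝ 1 X {x | μ < ‖x‖ ∧ ‖x‖ < μ'} →
      IntegrableOn X {x | μ < ‖x‖ ∧ ‖x‖ < μ'} volume →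
      (∀ x ∈ {x : EuclideanSpace ℝ (Fin n) | μ < ‖x‖ ∧ ‖x‖ < μ'}, ∀ i j : Fin n,
        fderivWithin ℝ X {x | μ < ‖x‖ ∧ ‖x‖ < μ'} x (EuclideanSpace.single j 1) i
          = fderivWithin ℝ X {x | μ < ‖x‖ ∧ ‖x‖ < μ'} x
              (EuclideanSpace.single i 1) j) →
      ∃ u : EuclideanSpace ℝ (Fin n) → ℝ,
        ContDiffOn ℝ 1 u {x | 1 < ‖x‖ ∧ ‖x‖ < lam} ∧
        (∀ x ∈ {x : EuclideanSpace ℝ (Fin n) | 1 < ‖x‖ ∧ ‖x‖ < lam}, ∀ i : Fin n,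
          fderivWithin ℝ u {x | 1 < ‖x‖ ∧ ‖x‖ < lam} x (EuclideanSpace.single i 1)
            = X x i) ∧
        IntegrableOn u {x | 1 < ‖x‖ ∧ ‖x‖ < lam} volume ∧
        ∫ x in {x : EuclideanSpace ℝ (Fin n) | 1 < ‖x‖ ∧ ‖x‖ < lam}, |u x| ≤
          C * ∫ x in {x : EuclideanSpace ℝ (Fin n) | μ < ‖x‖ ∧ ‖x‖ < μ'}, ‖X x‖ := by
  set U : Set (EuclideanSpace ℝ (Fin n)) := {x | μ < ‖x‖ ∧ ‖x‖ < μ'}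
  set A : Set (EuclideanSpace ℝ (Fin n)) := {x | 1 < ‖x‖ ∧ ‖x‖ < lam}
  have hU : IsOpen U := isOpen_shell
  have hA : IsOpen A := isOpen_shell
  have hμμ' : μ < μ' := by linarith
  have hrank : 3 ≤ Module.finrank ℝ (EuclideanSpace ℝ (Fin n)) := by simpa using hn
  have hAU : A ⊆ U := fun x hx => ⟨hμ1.trans hx.1, hx.2.trans hlamμ'⟩
  set K : Set (EuclideanSpace ℝ (Fin n)) := {x | 1 ≤ ‖x‖ ∧ ‖x‖ ≤ lam}
  have hAK : A ⊆ K := fun x hx => ⟨hx.1.le, hx.2.le⟩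
  have hK : IsCompact K := by
    refine (isCompact_closedBall (0 : EuclideanSpace ℝ (Fin n)) lam).of_isClosed_subset
      ((isClosed_le continuous_const continuous_norm).inter
        (isClosed_le continuous_norm continuous_const)) fun x hx => ?_
    simpa using hx.2
  obtain ⟨C, hC, hPoincare⟩ := exists_lintegral_enorm_sub_const_le (ν := volume) hU
    (isConnected_shell (by omega) h0μ hμμ') hK
    (fun x hx => ⟨hμ1.trans_le hx.1, hx.2.trans_lt hlamμ'⟩)
  refine ⟨C.toReal + 1, by positivity, fun X hX hXint hclosed => ?_⟩
  set L := innerSL ℝ (E := EuclideanSpace ℝ (Fin n))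
  set ω : EuclideanSpace ℝ (Fin n) → EuclideanSpace ℝ (Fin n) →L[ℝ] ℝ := fun x => L (X x)
  have hXd : ∀ x ∈ U, DifferentiableAt ℝ X x := fun x hx =>
    (hX.differentiableOn one_ne_zero).differentiableAt (hU.mem_nhds hx)
  have hωf : ∀ x ∈ U, HasFDerivAt ω (L.comp (fderiv ℝ X x)) x := fun x hx =>
    L.hasFDerivAt.comp x (hXd x hx).hasFDerivAt
  have hsymm : ∀ p ∈ U, ∀ x y, fderiv ℝ ω p x y = fderiv ℝ ω p y x := fun p hp => by
    rw [(hωf p hp).fderiv]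
    exact inner_apply_symmetric_of_single fun i j => by
      simpa only [fderivWithin_of_isOpen hU hp] using hclosed p hp i j
  obtain ⟨f, hf⟩ := exists_hasFDerivAt_shell hrank h0μ hμμ'
    (fun x hx => (hωf x hx).differentiableAt.differentiableWithinAt) hsymm
  have hfC : ContDiffOn ℝ 1 f U := by
    rw [show (1 : WithTop ℕ∞) = 0 + 1 by simp, contDiffOn_succ_iff_fderiv_of_isOpen hU]
    refine ⟨fun x hx => (hf x hx).differentiableAt.differentiableWithinAt, by simp, ?_⟩
    rw [contDiffOn_zero]
    exact (L.continuous.comp_continuousOn hX.continuousOn).congr fun x hx => (hf x hx).fderiv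
  obtain ⟨c, hc⟩ := hPoincare f hfC
  have hnorm : ∫⁻ x in U, ‖fderiv ℝ f x‖ₑ = ∫⁻ x in U, ‖X x‖ₑ :=
    setLIntegral_congr_fun hU.measurableSet fun x hx => by
      simp only [(hf x hx).fderiv, ← ofReal_norm]
      exact congrArg ENNReal.ofReal (innerSL_apply_norm ℝ (X x))
  rw [hnorm] at hc
  have hle : ∫⁻ x in A, ‖f x - c‖ₑ ≤ C * ∫⁻ x in U, ‖X x‖ₑ := (lintegral_mono_set hAK).trans hc
  have hXfin : ∫⁻ x in U, ‖X x‖ₑ ≠ ∞ := hXint.2.ne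
  have hu : ContDiffOn ℝ 1 (fun x => f x - c) A := (hfC.mono hAU).sub contDiffOn_const
  refine ⟨fun x => f x - c, hu, fun x hx i => ?_, ⟨?_, ?_⟩, ?_⟩
  · rw [fderivWithin_of_isOpen hA hx, ((hf x (hAU hx)).sub_const c).fderiv]
    simp [ω, L, EuclideanSpace.inner_single_right]
  · exact hu.continuousOn.aestronglyMeasurable hA.measurableSet
  · exact hle.trans_lt (ENNReal.mul_lt_top hC.lt_top hXfin.lt_top)
  · have hmeas := hu.continuousOn.aestronglyMeasurable (μ := volume) hA.measurableSet
    have h1 : ∫ x in A, |f x - c| = (∫⁻ x in A, ‖f x - c‖ₑ).toReal :=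
      integral_norm_eq_lintegral_enorm hmeas
    rw [h1, integral_norm_eq_lintegral_enorm hXint.1]
    refine (ENNReal.toReal_mono (ENNReal.mul_ne_top hC hXfin) hle).trans ?_
    rw [ENNReal.toReal_mul]
    gcongr
    linarith
end
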